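/- Let Λ* ⊆ (F⁺_d)^N be a factorial language and let ∅ ≠ F ⊆ [N]. Then K_F = { a ∈ A : a Q_F = a }; that is, an element a ∈ A satisfies T_{δ_i(k)}* a T_{δ_i(k)} = 0 for all i ∈ F and k ∈ [d] if and only if a Q_F = a. -/

import Mathlib

open scoped ENNReal

/-- The `N`-fold direct product of the free monoid on `d` generators,
with coordinatewise multiplication. -/
abbrev MWord (d N : ℕ) : Type := Fin N → FreeMonoid (Fin d)

/-- The element of `(F⁺_d)^N` whose `i`-th coordinate is the one-letter word `k`
and whose other coordinates are empty. -/
def delta (d N : ℕ) (i : Fin N) (k : Fin d) : MWord d N :=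
  fun j => if j = i then FreeMonoid.of k else 1

/-- `ν` is a factor of `μ` if `μ = w * ν * q` for some `w, q`. -/
def IsFactor {d N : ℕ} (ν μ : MWord d N) : Prop :=
  ∃ w q : MWord d N, μ = w * ν * q

/-- A factorial language in `(F⁺_d)^N`. -/
def IsFL {d N : ℕ} (Λ : Set (MWord d N)) : Prop :=
  (∀ i : Fin N, ∃ k : Fin d, delta d N i k ∈ Λ) ∧
  ∀ μ ∈ Λ, ∀ ν : MWord d N, IsFactor ν μ → ν ∈ Λ

/-- The multilength of a multiword. -/
def mlen {d N : ℕ} (μ : MWord d N) : Fin N → ℕ := fun i => (μ i).length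

/-- The support of a multiword. -/
def msupp {d N : ℕ} (μ : MWord d N) : Set (Fin N) := {i | μ i ≠ 1}

noncomputable section

/-- The Hilbert space `ℓ²(Λ*)`. -/
abbrev ell2 {d N : ℕ} (Λ : Set (MWord d N)) : Type := lp (fun _ : Λ => ℂ) 2

/-- The standard orthonormal basis vector `e_w̄` of `ℓ²(Λ*)`. -/
def evec {d N : ℕ} (Λ : Set (MWord d N)) (w : Λ) : ell2 Λ :=
  letI := Classical.decEq (↥Λ)
  lp.single 2 w 1

end

noncomputable section

/-- The C*-algebra of checkers of a factorial language: the unital commutative C*-subalgebra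
of `B(ℓ²(Λ*))` generated by the projections `T_μ̄* T_μ̄`, `μ̄ ∈ Λ*`. -/
def checkers {d N : ℕ} (Λ : Set (MWord d N)) (T : MWord d N → (ell2 Λ →L[ℂ] ell2 Λ)) :
    StarSubalgebra ℂ (ell2 Λ →L[ℂ] ell2 Λ) :=
  (StarAlgebra.adjoin ℂ {x : ell2 Λ →L[ℂ] ell2 Λ | ∃ μ ∈ Λ, x = star (T μ) * T μ}).topologicalClosure

/-- `P_i = Σ_{k∈[d]} T_{δ_i(k)} T_{δ_i(k)}*`. -/
def Pproj {d N : ℕ} (Λ : Set (MWord d N)) (T : MWord d N → (ell2 Λ →L[ℂ] ell2 Λ))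
    (i : Fin N) : ell2 Λ →L[ℂ] ell2 Λ :=
  ∑ k : Fin d, T (delta d N i k) * star (T (delta d N i k))

/-- `Q_F = Π_{i∈F} (I − P_i)`, the product taken in the increasing order of `[N]`
(the factors pairwise commute, so the order is immaterial); `Q_∅ = I`. -/
def Qproj {d N : ℕ} (Λ : Set (MWord d N)) (T : MWord d N → (ell2 Λ →L[ℂ] ell2 Λ))
    (F : Finset (Fin N)) : ell2 Λ →L[ℂ] ell2 Λ :=
  ((List.finRange N).filter (· ∈ F)).foldr (fun i acc => (1 - Pproj Λ T i) * acc) 1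

/-- `K_F = { a ∈ A : α_{δ_i(k)}(a) = 0 for all i ∈ F, k ∈ [d] }`. -/
def Kset {d N : ℕ} (Λ : Set (MWord d N)) (T : MWord d N → (ell2 Λ →L[ℂ] ell2 Λ))
    (F : Finset (Fin N)) : Set (ell2 Λ →L[ℂ] ell2 Λ) :=
  {a | a ∈ checkers Λ T ∧
    ∀ i ∈ F, ∀ k : Fin d, star (T (delta d N i k)) * a * T (delta d N i k) = 0}

/-- `J_F = { a ∈ A : a b = 0 for all b ∈ K_F }`. -/
def Jset {d N : ℕ} (Λ : Set (MWord d N)) (T : MWord d N → (ell2 Λ →L[ℂ] ell2 Λ))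
    (F : Finset (Fin N)) : Set (ell2 Λ →L[ℂ] ell2 Λ) :=
  {a | a ∈ checkers Λ T ∧ ∀ b ∈ Kset Λ T F, a * b = 0}

/-- `I_F = { a ∈ J_F : α_μ̄(a) ∈ J_F for all μ̄ ∈ Λ* with supp μ̄ ∩ F = ∅ }`. -/
def Iset {d N : ℕ} (Λ : Set (MWord d N)) (T : MWord d N → (ell2 Λ →L[ℂ] ell2 Λ))
    (F : Finset (Fin N)) : Set (ell2 Λ →L[ℂ] ell2 Λ) :=
  {a | a ∈ Jset Λ T F ∧
    ∀ μ ∈ Λ, msupp μ ∩ (↑F : Set (Fin N)) = ∅ → star (T μ) * a * T μ ∈ Jset Λ T F}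

end

section Checkers

open scoped InnerProductSpace

variable {d N : ℕ} {Λ : Set (MWord d N)}

theorem evec_apply_self (w : Λ) : evec Λ w w = 1 := by
  simp [evec]

theorem evec_apply_ne {v w : Λ} (h : v ≠ w) : evec Λ w v = 0 := by
  simp [evec, h]

theorem inner_evec_left (w : Λ) (x : ell2 Λ) : ⟪evec Λ w, x⟫_ℂ = x w := by
  classical
  simp [evec, lp.inner_single_left]

theorem inner_evec_right (w : Λ) (x : ell2 Λ) : ⟪x, evec Λ w⟫_ℂ = star (x w) := by
  rw [← inner_conj_symm, inner_evec_left]; rfl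

/-- Operators on `ℓ²(Λ*)` are determined by their values on the standard basis. -/
theorem clm_ext_evec {a b : ell2 Λ →L[ℂ] ell2 Λ} (h : ∀ w, a (evec Λ w) = b (evec Λ w)) :
    a = b := by
  classical
  have key : ∀ (x : ell2 Λ) (w : Λ), lp.single 2 w (x w) = x w • evec Λ w := by
    intro x w
    ext v
    by_cases hv : v = w
    · subst hv; simp [evec]
    · simp [evec, hv]
  ext1 x
  have hx := lp.hasSum_single (p := 2) (by simp) x
  refine (hx.mapL a).unique ?_
  convert hx.mapL b using 2 with w
  rw [key, map_smul, map_smul, h]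

theorem mem_checkers_evec_apply {T : MWord d N → (ell2 Λ →L[ℂ] ell2 Λ)}
    (hT1 : ∀ (μ : MWord d N) (w : Λ) (h : μ * (w : MWord d N) ∈ Λ),
      T μ (evec Λ w) = evec Λ ⟨μ * (w : MWord d N), h⟩)
    (hT2 : ∀ (μ : MWord d N) (w : Λ), μ * (w : MWord d N) ∉ Λ → T μ (evec Λ w) = 0)
    {a : ell2 Λ →L[ℂ] ell2 Λ} (ha : a ∈ checkers Λ T) (w : Λ) :
    a (evec Λ w) = a (evec Λ w) w • evec Λ w := by
  have eigen : ∀ {b : ell2 Λ →L[ℂ] ell2 Λ},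
      (∀ v w : Λ, v ≠ w → ⟪evec Λ v, b (evec Λ w)⟫_ℂ = 0) → ∀ w,
      b (evec Λ w) = b (evec Λ w) w • evec Λ w := by
    intro b hb w
    ext v
    by_cases hv : v = w
    · subst hv; simp [evec_apply_self]
    · have := hb v w hv
      rw [inner_evec_left] at this
      simp [this, evec_apply_ne hv]
  refine eigen (fun v w hvw => ?_) w
  revert a
  have hclosed : IsClosed {a : ell2 Λ →L[ℂ] ell2 Λ | ⟪evec Λ v, a (evec Λ w)⟫_ℂ = 0} :=
    isClosed_eq (by fun_prop) continuous_const
  refine fun {a} ha => closure_minimal ?_ hclosed ha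
  intro b hb
  suffices ∀ v w : Λ, v ≠ w → ⟪evec Λ v, b (evec Λ w)⟫_ℂ = 0 from this v w hvw
  clear hclosed hvw v w ha
  induction hb using StarAlgebra.adjoin_induction with
  | mem x hx =>
    obtain ⟨μ, -, rfl⟩ := hx
    intro v w hvw
    rw [mul_apply_eq_comp, ContinuousLinearMap.star_eq_adjoint,
      ContinuousLinearMap.adjoint_inner_right]
    by_cases hv : μ * (v : MWord d N) ∈ Λ
    · by_cases hw : μ * (w : MWord d N) ∈ Λ
      · rw [hT1 μ v hv, hT1 μ w hw, inner_evec_left, evec_apply_ne]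
        intro h
        exact hvw (Subtype.ext (mul_left_cancel (congrArg Subtype.val h)))
      · rw [hT2 μ w hw, inner_zero_right]
    · rw [hT2 μ v hv, inner_zero_left]
  | algebraMap r =>
    intro v w hvw
    simp [Algebra.algebraMap_eq_smul_one, inner_evec_left, evec_apply_ne hvw]
  | add x y _ _ hx hy =>
    intro v w hvw
    simp [hx v w hvw, hy v w hvw]
  | mul x y _ _ hx hy =>
    intro v w hvw
    rw [mul_apply_eq_comp, eigen hy w, map_smul, inner_smul_right, hx v w hvw,
      mul_zero]
  | star x _ hx =>
    intro v w hvw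
    rw [ContinuousLinearMap.star_eq_adjoint, ContinuousLinearMap.adjoint_inner_right,
      ← inner_conj_symm, hx w v hvw.symm, map_zero]

theorem star_T_evec_apply (T : MWord d N → (ell2 Λ →L[ℂ] ell2 Λ)) (μ : MWord d N)
    (u w : Λ) :
    star (T μ) (evec Λ u) w = star (T μ (evec Λ w) u) := by
  rw [← inner_evec_left, ContinuousLinearMap.star_eq_adjoint,
    ContinuousLinearMap.adjoint_inner_right, inner_evec_right]

section Shift

variable {T : MWord d N → (ell2 Λ →L[ℂ] ell2 Λ)}
  (hT1 : ∀ (μ : MWord d N) (w : Λ) (h : μ * (w : MWord d N) ∈ Λ),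
    T μ (evec Λ w) = evec Λ ⟨μ * (w : MWord d N), h⟩)
  (hT2 : ∀ (μ : MWord d N) (w : Λ), μ * (w : MWord d N) ∉ Λ → T μ (evec Λ w) = 0)

include hT1 hT2

theorem star_T_evec_of_eq {μ : MWord d N} {u w : Λ} (h : (u : MWord d N) = μ * w) :
    star (T μ) (evec Λ u) = evec Λ w := by
  ext v
  rw [star_T_evec_apply]
  by_cases hv : μ * (v : MWord d N) ∈ Λ
  · rw [hT1 μ v hv]
    by_cases hvw : v = w
    · subst hvw
      obtain rfl : u = ⟨μ * v, hv⟩ := Subtype.ext h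
      simp [evec_apply_self]
    · rw [evec_apply_ne hvw, evec_apply_ne, star_zero]
      intro hu
      exact hvw (Subtype.ext (mul_left_cancel ((congrArg Subtype.val hu).symm.trans h)))
  · have hvw : v ≠ w := by
      rintro rfl
      exact hv (h ▸ u.2)
    rw [hT2 μ v hv, evec_apply_ne hvw]
    simp

theorem star_T_evec_of_forall_ne {μ : MWord d N} {u : Λ}
    (h : ∀ w : Λ, (u : MWord d N) ≠ μ * w) : star (T μ) (evec Λ u) = 0 := by
  ext v
  rw [star_T_evec_apply]
  by_cases hv : μ * (v : MWord d N) ∈ Λ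
  · rw [hT1 μ v hv, evec_apply_ne fun hu => h v (congrArg Subtype.val hu)]
    simp
  · rw [hT2 μ v hv]
    simp

end Shift

theorem delta_mul_apply_self (i : Fin N) (k : Fin d) (w : MWord d N) :
    (delta d N i k * w) i = FreeMonoid.of k * w i := by
  simp [delta]

theorem delta_mul_apply_self_ne_one (i : Fin N) (k : Fin d) (w : MWord d N) :
    (delta d N i k * w) i ≠ 1 := by
  rw [delta_mul_apply_self]
  exact List.cons_ne_nil k (w i)

/-- A multiword of a factorial language with nonempty `i`-th coordinate starts with a
one-letter word in that coordinate. -/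
theorem exists_eq_delta_mul (hFL : IsFL Λ) (u : Λ) {i : Fin N} (hu : (u : MWord d N) i ≠ 1) :
    ∃ (k : Fin d) (w : Λ), (u : MWord d N) = delta d N i k * w := by
  obtain ⟨k, t, ht⟩ : ∃ (k : Fin d) (t : FreeMonoid (Fin d)),
      (u : MWord d N) i = FreeMonoid.of k * t := List.exists_cons_of_ne_nil hu
  have hmul : (u : MWord d N) = delta d N i k * Function.update (u : MWord d N) i t := by
    funext j
    by_cases hj : j = i
    · subst hj
      rw [delta_mul_apply_self, Function.update_self]
      exact ht
    · rw [Pi.mul_apply, Function.update_of_ne hj, delta, if_neg hj, one_mul]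
  exact ⟨k, ⟨_, hFL.2 u u.2 _ ⟨delta d N i k, 1, by rw [mul_one]; exact hmul⟩⟩, hmul⟩

section Projections

variable {T : MWord d N → (ell2 Λ →L[ℂ] ell2 Λ)}
  (hT1 : ∀ (μ : MWord d N) (w : Λ) (h : μ * (w : MWord d N) ∈ Λ),
    T μ (evec Λ w) = evec Λ ⟨μ * (w : MWord d N), h⟩)
  (hT2 : ∀ (μ : MWord d N) (w : Λ), μ * (w : MWord d N) ∉ Λ → T μ (evec Λ w) = 0)

include hT1 hT2

theorem Pproj_evec_of_eq_one {u : Λ} {i : Fin N} (hu : (u : MWord d N) i = 1) :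
    Pproj Λ T i (evec Λ u) = 0 := by
  rw [Pproj, sum_apply]
  refine Finset.sum_eq_zero fun k _ => ?_
  rw [mul_apply_eq_comp, star_T_evec_of_forall_ne hT1 hT2, map_zero]
  intro w hw
  exact delta_mul_apply_self_ne_one i k w (hw ▸ hu)

theorem Pproj_evec_of_ne_one (hFL : IsFL Λ) {u : Λ} {i : Fin N} (hu : (u : MWord d N) i ≠ 1) :
    Pproj Λ T i (evec Λ u) = evec Λ u := by
  obtain ⟨k, w, hw⟩ := exists_eq_delta_mul hFL u hu
  rw [Pproj, sum_apply, Finset.sum_eq_single k]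
  · rw [mul_apply_eq_comp, star_T_evec_of_eq hT1 hT2 hw, hT1 _ _ (hw ▸ u.2)]
    exact congrArg _ (Subtype.ext hw.symm)
  · intro k' _ hk
    rw [mul_apply_eq_comp, star_T_evec_of_forall_ne hT1 hT2, map_zero]
    intro w' hw'
    have h := congrFun (hw'.symm.trans hw) i
    rw [delta_mul_apply_self, delta_mul_apply_self] at h
    exact hk (List.cons.inj h).1
  · simp

theorem Qproj_evec_of_forall_eq_one {F : Finset (Fin N)} {u : Λ}
    (hu : ∀ i ∈ F, (u : MWord d N) i = 1) : Qproj Λ T F (evec Λ u) = evec Λ u := by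
  have hL : ∀ i ∈ (List.finRange N).filter (· ∈ F), (u : MWord d N) i = 1 := by
    simpa using hu
  rw [Qproj]
  generalize (List.finRange N).filter (· ∈ F) = L at hL
  induction L with
  | nil => simp
  | cons i L ih =>
    rw [List.foldr_cons, mul_apply_eq_comp,
      ih fun j hj => hL j (List.mem_cons_of_mem _ hj), sub_apply,
      Pproj_evec_of_eq_one hT1 hT2 (hL i List.mem_cons_self), sub_zero,
      one_apply_eq_self]

theorem Qproj_evec_of_exists_ne_one (hFL : IsFL Λ) {F : Finset (Fin N)} {u : Λ}
    (hu : ∃ i ∈ F, (u : MWord d N) i ≠ 1) : Qproj Λ T F (evec Λ u) = 0 := by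
  have hL : ∃ i ∈ (List.finRange N).filter (· ∈ F), (u : MWord d N) i ≠ 1 := by
    simpa using hu
  rw [Qproj]
  generalize (List.finRange N).filter (· ∈ F) = L at hL
  suffices ∀ L : List (Fin N),
      L.foldr (fun i acc => (1 - Pproj Λ T i) * acc) 1 (evec Λ u) = evec Λ u ∧
        (∀ i ∈ L, (u : MWord d N) i = 1) ∨
      L.foldr (fun i acc => (1 - Pproj Λ T i) * acc) 1 (evec Λ u) = 0 by
    obtain ⟨i, hi, hne⟩ := hL
    exact (this L).resolve_left fun h => hne (h.2 i hi)
  clear hL L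
  intro L
  induction L with
  | nil => simp
  | cons i L ih =>
    rw [List.foldr_cons, mul_apply_eq_comp]
    obtain ⟨ih, hone⟩ | ih := ih
    · rw [ih, sub_apply, one_apply_eq_self]
      by_cases hi : (u : MWord d N) i = 1
      · left
        rw [Pproj_evec_of_eq_one hT1 hT2 hi, sub_zero]
        exact ⟨rfl, by simpa [hi] using hone⟩
      · right
        rw [Pproj_evec_of_ne_one hT1 hT2 hFL hi, sub_self]
    · right
      rw [ih, map_zero]

end Projections

end Checkers

noncomputable section

/-- For a factorial language `Λ*` and `∅ ≠ F ⊆ [N]`: `K_F = { a ∈ A : a Q_F = a }`;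
that is, an element `a ∈ A` satisfies `T_{δ_i(k)}* a T_{δ_i(k)} = 0` for all `i ∈ F` and
`k ∈ [d]` if and only if `a Q_F = a`. -/
theorem Kset_eq_fixed_by_Qproj {d N : ℕ} (Λ : Set (MWord d N)) (hFL : IsFL Λ)
    (T : MWord d N → (ell2 Λ →L[ℂ] ell2 Λ))
    (hT1 : ∀ (μ : MWord d N) (w : Λ) (h : μ * (w : MWord d N) ∈ Λ),
      T μ (evec Λ w) = evec Λ ⟨μ * (w : MWord d N), h⟩)
    (hT2 : ∀ (μ : MWord d N) (w : Λ), μ * (w : MWord d N) ∉ Λ → T μ (evec Λ w) = 0)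
    (F : Finset (Fin N)) (hF : F.Nonempty) :
    Kset Λ T F = {a | a ∈ checkers Λ T ∧ a * Qproj Λ T F = a} := by
  ext a
  refine and_congr_right fun ha => ⟨fun hK => clm_ext_evec fun u => ?_, fun hQ i hi k =>
    clm_ext_evec fun w => ?_⟩
  · rw [mul_apply_eq_comp]
    by_cases hu : ∀ i ∈ F, (u : MWord d N) i = 1
    · rw [Qproj_evec_of_forall_eq_one hT1 hT2 hu]
    · push Not at hu
      rw [Qproj_evec_of_exists_ne_one hT1 hT2 hFL hu, map_zero]
      obtain ⟨i, hi, hne⟩ := hu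
      obtain ⟨k, w, hw⟩ := exists_eq_delta_mul hFL u hne
      have hTw : T (delta d N i k) (evec Λ w) = evec Λ u := by
        rw [hT1 _ _ (hw ▸ u.2)]
        exact congrArg _ (Subtype.ext hw.symm)
      have h := congrArg (fun b : ell2 Λ →L[ℂ] ell2 Λ => b (evec Λ w) w) (hK i hi k)
      have hdiag := mem_checkers_evec_apply hT1 hT2 ha u
      simp only [mul_apply_eq_comp] at h
      rw [hTw, hdiag, map_smul, star_T_evec_of_eq hT1 hT2 hw] at h
      have hc : a (evec Λ u) u = 0 := by simpa [evec_apply_self] using h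
      rw [hdiag, hc, zero_smul]
  · rw [mul_apply_eq_comp, mul_apply_eq_comp]
    by_cases hw : delta d N i k * (w : MWord d N) ∈ Λ
    · rw [hT1 _ _ hw, ← hQ, mul_apply_eq_comp,
        Qproj_evec_of_exists_ne_one hT1 hT2 hFL ⟨i, hi, delta_mul_apply_self_ne_one i k w⟩]
      simp
    · rw [hT2 _ _ hw]
      simp

end
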